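/- arXiv:2506.13645 — 2 statements merged into one kernel-verified Lean document; each statement's English description precedes it below -/
import Mathlib

section
/- Let ν > 0 and let k₁, k₂, b₁, b₂ ∈ ℝ with |k₁| + |k₂| ≠ 0. Let I ⊆ ℝ be an open interval and let γ(t) = (k₁t + b₁, k₂t + b₂). Let U ⊆ ℝ×ℝ be an open set containing γ(I), and let u₁, u₂, f₁, f₂, g₁, g₂, p, φ : ℝ×ℝ → ℝ be smooth. Suppose that at every point of U: −ν·Δu₁ + p_x = f₁, −ν·Δu₂ + p_y = f₂, and −(u₁)_x − (u₂)_y = φ; and suppose u₁(γ(t)) = g₁(γ(t)) and u₂(γ(t)) = g₂(γ(t)) for all t ∈ I. Then at every point γ(t) with t ∈ I: (k₁³ + k₂³)·(u₂)_xxx + k₁²(3k₂ − k₁)·(u₂)_xxy + k₂(2k₂² + 3k₁k₂ − 3k₁²)·(u₂)_xyy + k₂²(k₂ − 3k₁)·(u₂)_yyy = k₁³·φ_xx + k₂(3k₁² − k₂²)·φ_xy + 3k₁k₂²·φ_yy + ν⁻¹·k₂³·((f₁)_y − (f₂)_x) + ρ₁ + ρ₂, where ρ_r = k₁³·(g_r)_xxx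 + 3k₁²k₂·(g_r)_xxy + 3k₁k₂²·(g_r)_xyy + k₂³·(g_r)_yyy for r = 1, 2. -/
/-- Partial derivative in the `x`-direction. -/
noncomputable def px (v : ℝ × ℝ → ℝ) : ℝ × ℝ → ℝ := fun z => fderiv ℝ v z (1, 0)

/-- Partial derivative in the `y`-direction. -/
noncomputable def py (v : ℝ × ℝ → ℝ) : ℝ × ℝ → ℝ := fun z => fderiv ℝ v z (0, 1)

/-- Laplacian `Δv = v_xx + v_yy`. -/
noncomputable def lap (v : ℝ × ℝ → ℝ) : ℝ × ℝ → ℝ := fun z => px (px v) z + py (py v) z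


section helpers

theorem aux_px_smooth {v : ℝ × ℝ → ℝ} (hv : ContDiff ℝ (⊤ : ℕ∞) v) :
    ContDiff ℝ (⊤ : ℕ∞) (px v) := by
  have h : ContDiff ℝ (⊤ : ℕ∞) (fderiv ℝ v) := hv.fderiv_right (by simp)
  exact h.clm_apply contDiff_const

theorem aux_py_smooth {v : ℝ × ℝ → ℝ} (hv : ContDiff ℝ (⊤ : ℕ∞) v) :
    ContDiff ℝ (⊤ : ℕ∞) (py v) := by
  have h : ContDiff ℝ (⊤ : ℕ∞) (fderiv ℝ v) := hv.fderiv_right (by simp)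
  exact h.clm_apply contDiff_const

theorem aux_diff {v : ℝ × ℝ → ℝ} (hv : ContDiff ℝ (⊤ : ℕ∞) v) : Differentiable ℝ v :=
  hv.differentiable (by simp)

theorem aux_comm {v : ℝ × ℝ → ℝ} (hv : ContDiff ℝ (⊤ : ℕ∞) v) :
    py (px v) = px (py v) := by
  have h : ContDiff ℝ (⊤ : ℕ∞) (fderiv ℝ v) := hv.fderiv_right (by simp)
  have hd : Differentiable ℝ (fderiv ℝ v) := h.differentiable (by simp)
  funext z
  have hs : IsSymmSndFDerivAt ℝ v z :=
    (hv.of_le (m := 2) (WithTop.coe_le_coe.2 (le_top : (2 : ℕ∞) ≤ ⊤))).contDiffAt.isSymmSndFDerivAt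
      (by simp)
  have e := hs (0, 1) (1, 0)
  unfold px py
  rw [fderiv_clm_apply (hd z) (differentiableAt_const _),
    fderiv_clm_apply (hd z) (differentiableAt_const _)]
  simpa using e

theorem aux_px_lin {v w : ℝ × ℝ → ℝ} (c d : ℝ) (hv : ContDiff ℝ (⊤ : ℕ∞) v)
    (hw : ContDiff ℝ (⊤ : ℕ∞) w) :
    px (fun z => c * v z + d * w z) = fun z => c * px v z + d * px w z := by
  funext z
  have h := ((aux_diff hv z).hasFDerivAt.const_mul c).add ((aux_diff hw z).hasFDerivAt.const_mul d)
  have e : fderiv ℝ (fun z => c * v z + d * w z) z = _ := h.fderiv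
  simp [px, e]

theorem aux_py_lin {v w : ℝ × ℝ → ℝ} (c d : ℝ) (hv : ContDiff ℝ (⊤ : ℕ∞) v)
    (hw : ContDiff ℝ (⊤ : ℕ∞) w) :
    py (fun z => c * v z + d * w z) = fun z => c * py v z + d * py w z := by
  funext z
  have h := ((aux_diff hv z).hasFDerivAt.const_mul c).add ((aux_diff hw z).hasFDerivAt.const_mul d)
  have e : fderiv ℝ (fun z => c * v z + d * w z) z = _ := h.fderiv
  simp [py, e]

theorem aux_lin_smooth {v w : ℝ × ℝ → ℝ} (c d : ℝ) (hv : ContDiff ℝ (⊤ : ℕ∞) v)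
    (hw : ContDiff ℝ (⊤ : ℕ∞) w) : ContDiff ℝ (⊤ : ℕ∞) (fun z => c * v z + d * w z) :=
  (contDiff_const.mul hv).add (contDiff_const.mul hw)

theorem aux_px_congr {U : Set (ℝ × ℝ)} (hU : IsOpen U) {v w : ℝ × ℝ → ℝ}
    (h : ∀ z ∈ U, v z = w z) : ∀ z ∈ U, px v z = px w z := by
  intro z hz
  have : v =ᶠ[nhds z] w := Filter.eventuallyEq_of_mem (hU.mem_nhds hz) h
  simp [px, this.fderiv_eq]

theorem aux_py_congr {U : Set (ℝ × ℝ)} (hU : IsOpen U) {v w : ℝ × ℝ → ℝ}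
    (h : ∀ z ∈ U, v z = w z) : ∀ z ∈ U, py v z = py w z := by
  intro z hz
  have : v =ᶠ[nhds z] w := Filter.eventuallyEq_of_mem (hU.mem_nhds hz) h
  simp [py, this.fderiv_eq]

/-- Derivative along the direction `(k₁, k₂)`. -/
noncomputable def auxD (k₁ k₂ : ℝ) (v : ℝ × ℝ → ℝ) : ℝ × ℝ → ℝ :=
  fun z => k₁ * px v z + k₂ * py v z

theorem auxD_smooth (k₁ k₂ : ℝ) {v : ℝ × ℝ → ℝ} (hv : ContDiff ℝ (⊤ : ℕ∞) v) :
    ContDiff ℝ (⊤ : ℕ∞) (auxD k₁ k₂ v) :=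
  aux_lin_smooth _ _ (aux_px_smooth hv) (aux_py_smooth hv)

theorem auxD_deriv (k₁ k₂ b₁ b₂ : ℝ) {v : ℝ × ℝ → ℝ} (hv : ContDiff ℝ (⊤ : ℕ∞) v) (t : ℝ) :
    HasDerivAt (fun t : ℝ => v (k₁ * t + b₁, k₂ * t + b₂))
      (auxD k₁ k₂ v (k₁ * t + b₁, k₂ * t + b₂)) t := by
  have h1 : HasDerivAt (fun t : ℝ => k₁ * t + b₁) k₁ t := by
    simpa using ((hasDerivAt_id t).const_mul k₁).add_const b₁
  have h2 : HasDerivAt (fun t : ℝ => k₂ * t + b₂) k₂ t := by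
    simpa using ((hasDerivAt_id t).const_mul k₂).add_const b₂
  have h3 := (aux_diff hv (k₁ * t + b₁, k₂ * t + b₂)).hasFDerivAt.comp_hasDerivAt t (h1.prodMk h2)
  have e : ((k₁, k₂) : ℝ × ℝ) = k₁ • ((1, 0) : ℝ × ℝ) + k₂ • ((0, 1) : ℝ × ℝ) := by simp
  rw [e, map_add, map_smul, map_smul] at h3
  exact h3

theorem auxD_congr (k₁ k₂ b₁ b₂ a b : ℝ) {v w : ℝ × ℝ → ℝ}
    (hv : ContDiff ℝ (⊤ : ℕ∞) v) (hw : ContDiff ℝ (⊤ : ℕ∞) w)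
    (h : ∀ t ∈ Set.Ioo a b, v (k₁ * t + b₁, k₂ * t + b₂) = w (k₁ * t + b₁, k₂ * t + b₂)) :
    ∀ t ∈ Set.Ioo a b, auxD k₁ k₂ v (k₁ * t + b₁, k₂ * t + b₂)
      = auxD k₁ k₂ w (k₁ * t + b₁, k₂ * t + b₂) := by
  intro t ht
  have e : (fun t : ℝ => v (k₁ * t + b₁, k₂ * t + b₂)) =ᶠ[nhds t]
      (fun t : ℝ => w (k₁ * t + b₁, k₂ * t + b₂)) :=
    Filter.eventuallyEq_of_mem (isOpen_Ioo.mem_nhds ht) h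
  exact (auxD_deriv k₁ k₂ b₁ b₂ hv t).unique
    ((auxD_deriv k₁ k₂ b₁ b₂ hw t).congr_of_eventuallyEq e)

theorem auxD_lin (k₁ k₂ c d : ℝ) {v w : ℝ × ℝ → ℝ} (hv : ContDiff ℝ (⊤ : ℕ∞) v)
    (hw : ContDiff ℝ (⊤ : ℕ∞) w) (z : ℝ × ℝ) :
    auxD k₁ k₂ (fun z => c * v z + d * w z) z = c * auxD k₁ k₂ v z + d * auxD k₁ k₂ w z := by
  unfold auxD
  rw [aux_px_lin c d hv hw, aux_py_lin c d hv hw]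
  ring

theorem auxD_three (k₁ k₂ : ℝ) {v : ℝ × ℝ → ℝ} (hv : ContDiff ℝ (⊤ : ℕ∞) v) (z : ℝ × ℝ) :
    auxD k₁ k₂ (auxD k₁ k₂ (auxD k₁ k₂ v)) z =
      k₁ ^ 3 * px (px (px v)) z + 3 * k₁ ^ 2 * k₂ * px (px (py v)) z
        + 3 * k₁ * k₂ ^ 2 * px (py (py v)) z + k₂ ^ 3 * py (py (py v)) z := by
  have hx := aux_px_smooth hv
  have hy := aux_py_smooth hv
  have e : auxD k₁ k₂ (auxD k₁ k₂ v)
      = fun z => k₁ * auxD k₁ k₂ (px v) z + k₂ * auxD k₁ k₂ (py v) z := by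
    funext z
    exact auxD_lin k₁ k₂ k₁ k₂ hx hy z
  rw [e, auxD_lin k₁ k₂ k₁ k₂ (auxD_smooth k₁ k₂ hx) (auxD_smooth k₁ k₂ hy)]
  have e1 : auxD k₁ k₂ (auxD k₁ k₂ (px v)) z = _ :=
    auxD_lin k₁ k₂ k₁ k₂ (aux_px_smooth hx) (aux_py_smooth hx) z
  have e2 : auxD k₁ k₂ (auxD k₁ k₂ (py v)) z = _ :=
    auxD_lin k₁ k₂ k₁ k₂ (aux_px_smooth hy) (aux_py_smooth hy) z
  rw [e1, e2]
  simp only [auxD]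
  rw [aux_comm hx, aux_comm hv, aux_comm hy]
  ring

end helpers

theorem third_order_boundary_pde_u2
    (ν k₁ k₂ b₁ b₂ : ℝ) (hν : 0 < ν) (hk : |k₁| + |k₂| ≠ 0)
    (a b : ℝ) (U : Set (ℝ × ℝ)) (hU : IsOpen U)
    (hγU : ∀ t ∈ Set.Ioo a b, (k₁ * t + b₁, k₂ * t + b₂) ∈ U)
    (u₁ u₂ f₁ f₂ g₁ g₂ p φ : ℝ × ℝ → ℝ)
    (hu₁ : ContDiff ℝ (⊤ : ℕ∞) u₁) (hu₂ : ContDiff ℝ (⊤ : ℕ∞) u₂)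
    (hf₁ : ContDiff ℝ (⊤ : ℕ∞) f₁) (hf₂ : ContDiff ℝ (⊤ : ℕ∞) f₂)
    (hg₁ : ContDiff ℝ (⊤ : ℕ∞) g₁) (hg₂ : ContDiff ℝ (⊤ : ℕ∞) g₂)
    (hp : ContDiff ℝ (⊤ : ℕ∞) p) (hφ : ContDiff ℝ (⊤ : ℕ∞) φ)
    (hm1 : ∀ z ∈ U, -ν * lap u₁ z + px p z = f₁ z)
    (hm2 : ∀ z ∈ U, -ν * lap u₂ z + py p z = f₂ z)
    (hdiv : ∀ z ∈ U, -(px u₁ z) - py u₂ z = φ z)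
    (hb1 : ∀ t ∈ Set.Ioo a b, u₁ (k₁ * t + b₁, k₂ * t + b₂) = g₁ (k₁ * t + b₁, k₂ * t + b₂))
    (hb2 : ∀ t ∈ Set.Ioo a b, u₂ (k₁ * t + b₁, k₂ * t + b₂) = g₂ (k₁ * t + b₁, k₂ * t + b₂)) :
    ∀ t ∈ Set.Ioo a b, ∀ z : ℝ × ℝ, z = (k₁ * t + b₁, k₂ * t + b₂) →
      (k₁ ^ 3 + k₂ ^ 3) * px (px (px u₂)) z
        + k₁ ^ 2 * (3 * k₂ - k₁) * px (px (py u₂)) z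
        + k₂ * (2 * k₂ ^ 2 + 3 * k₁ * k₂ - 3 * k₁ ^ 2) * px (py (py u₂)) z
        + k₂ ^ 2 * (k₂ - 3 * k₁) * py (py (py u₂)) z
      = k₁ ^ 3 * px (px φ) z
        + k₂ * (3 * k₁ ^ 2 - k₂ ^ 2) * px (py φ) z
        + 3 * k₁ * k₂ ^ 2 * py (py φ) z
        + ν⁻¹ * k₂ ^ 3 * (py f₁ z - px f₂ z)
        + (k₁ ^ 3 * px (px (px g₁)) z + 3 * k₁ ^ 2 * k₂ * px (px (py g₁)) z
            + 3 * k₁ * k₂ ^ 2 * px (py (py g₁)) z + k₂ ^ 3 * py (py (py g₁)) z)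
        + (k₁ ^ 3 * px (px (px g₂)) z + 3 * k₁ ^ 2 * k₂ * px (px (py g₂)) z
            + 3 * k₁ * k₂ ^ 2 * px (py (py g₂)) z + k₂ ^ 3 * py (py (py g₂)) z) := by
  intro t ht z hz
  have hzU : z ∈ U := hz ▸ hγU t ht
  have h1 := auxD_congr k₁ k₂ b₁ b₂ a b (auxD_smooth k₁ k₂ (auxD_smooth k₁ k₂ hu₁))
    (auxD_smooth k₁ k₂ (auxD_smooth k₁ k₂ hg₁))
    (auxD_congr k₁ k₂ b₁ b₂ a b (auxD_smooth k₁ k₂ hu₁) (auxD_smooth k₁ k₂ hg₁)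
      (auxD_congr k₁ k₂ b₁ b₂ a b hu₁ hg₁ hb1)) t ht
  have h2 := auxD_congr k₁ k₂ b₁ b₂ a b (auxD_smooth k₁ k₂ (auxD_smooth k₁ k₂ hu₂))
    (auxD_smooth k₁ k₂ (auxD_smooth k₁ k₂ hg₂))
    (auxD_congr k₁ k₂ b₁ b₂ a b (auxD_smooth k₁ k₂ hu₂) (auxD_smooth k₁ k₂ hg₂)
      (auxD_congr k₁ k₂ b₁ b₂ a b hu₂ hg₂ hb2)) t ht
  rw [← hz, auxD_three k₁ k₂ hu₁, auxD_three k₁ k₂ hg₁] at h1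
  rw [← hz, auxD_three k₁ k₂ hu₂, auxD_three k₁ k₂ hg₂] at h2
  have hx1 := aux_px_smooth hu₁
  have hy1 := aux_py_smooth hu₁
  have hx2 := aux_px_smooth hu₂
  have hy2 := aux_py_smooth hu₂
  have hxx1 := aux_px_smooth hx1
  have hyy1 := aux_py_smooth hy1
  have hxx2 := aux_px_smooth hx2
  have hyy2 := aux_py_smooth hy2
  -- divergence equation
  have d0 : ∀ z ∈ U, φ z = (fun z => (-1) * px u₁ z + (-1) * py u₂ z) z := by
    intro z hz
    simp only [← hdiv z hz]
    ring
  have dx := aux_px_congr hU d0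
  have dy := aux_py_congr hU d0
  rw [aux_px_lin (-1) (-1) hx1 hy2] at dx
  rw [aux_py_lin (-1) (-1) hx1 hy2] at dy
  have dxx := aux_px_congr hU dx z hzU
  have dxy := aux_px_congr hU dy z hzU
  have dyy := aux_py_congr hU dy z hzU
  rw [aux_px_lin (-1) (-1) hxx1 (aux_px_smooth hy2)] at dxx
  rw [aux_px_lin (-1) (-1) (aux_py_smooth hx1) hyy2, aux_comm hu₁] at dxy
  rw [aux_py_lin (-1) (-1) (aux_py_smooth hx1) hyy2, aux_comm hu₁, aux_comm hy1] at dyy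
  -- momentum equations
  have hl1 : ContDiff ℝ (⊤ : ℕ∞) (fun z => 1 * px (px u₁) z + 1 * py (py u₁) z) :=
    aux_lin_smooth 1 1 hxx1 hyy1
  have hl2 : ContDiff ℝ (⊤ : ℕ∞) (fun z => 1 * px (px u₂) z + 1 * py (py u₂) z) :=
    aux_lin_smooth 1 1 hxx2 hyy2
  have m1 : ∀ z ∈ U, f₁ z
      = (fun z => (-ν) * (fun z => 1 * px (px u₁) z + 1 * py (py u₁) z) z + 1 * px p z) z := by
    intro z hz
    simp only [← hm1 z hz, lap]
    ring
  have m2 : ∀ z ∈ U, f₂ z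
      = (fun z => (-ν) * (fun z => 1 * px (px u₂) z + 1 * py (py u₂) z) z + 1 * py p z) z := by
    intro z hz
    simp only [← hm2 z hz, lap]
    ring
  have m1y := aux_py_congr hU m1 z hzU
  have m2x := aux_px_congr hU m2 z hzU
  rw [aux_py_lin (-ν) 1 hl1 (aux_px_smooth hp), aux_py_lin 1 1 hxx1 hyy1, aux_comm hp,
    aux_comm hx1, aux_comm hu₁] at m1y
  rw [aux_px_lin (-ν) 1 hl2 (aux_py_smooth hp), aux_px_lin 1 1 hxx2 hyy2] at m2x
  have hF : ν⁻¹ * (py f₁ z - px f₂ z) = -(px (px (py u₁)) z + py (py (py u₁)) z)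
      + (px (px (px u₂)) z + px (py (py u₂)) z) := by
    rw [m1y, m2x]
    field_simp
    ring
  have hF' : ν⁻¹ * k₂ ^ 3 * (py f₁ z - px f₂ z)
      = k₂ ^ 3 * (-(px (px (py u₁)) z + py (py (py u₁)) z)
      + (px (px (px u₂)) z + px (py (py u₂)) z)) := by
    rw [← hF]
    ring
  rw [hF', ← h1, ← h2, dxx, dxy, dyy]
  ring
end

section
/- Let ν > 0, let β ∈ ℝ, let (a,b) ⊆ ℝ be an open interval, and let U ⊆ ℝ×ℝ be an open set containing the horizontal segment {(x, β) : x ∈ (a,b)}. Let u₁, u₂, f₁, f₂, p, φ, g₂ : ℝ×ℝ → ℝ be smooth functions such that at every point of U: −ν·Δu₁ + p_x = f₁, −ν·Δu₂ + p_y = f₂, and −(u₁)_x − (u₂)_y = φ; and such that u₂(x, β) = g₂(x, β) for all x ∈ (a,b). Then for every x ∈ (a,b): (u₁)_yyy(x, β) + 2·(u₁)_xxy(x, β) = −ν⁻¹·((f₁)_y(x, β) − (f₂)_x(x, β)) − φ_xy(x, β) + (g₂)_xxx(x, β). -/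
lemma smooth_px {v : ℝ × ℝ → ℝ} (h : ContDiff ℝ (⊤ : ℕ∞) v) : ContDiff ℝ (⊤ : ℕ∞) (px v) :=
  (h.fderiv_right (m := (⊤ : ℕ∞)) (by norm_cast)).clm_apply contDiff_const

lemma smooth_py {v : ℝ × ℝ → ℝ} (h : ContDiff ℝ (⊤ : ℕ∞) v) : ContDiff ℝ (⊤ : ℕ∞) (py v) :=
  (h.fderiv_right (m := (⊤ : ℕ∞)) (by norm_cast)).clm_apply contDiff_const

lemma smooth_diff {v : ℝ × ℝ → ℝ} (h : ContDiff ℝ (⊤ : ℕ∞) v) (z : ℝ × ℝ) :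
    DifferentiableAt ℝ v z := (h.differentiable (by simp)) z

lemma px_py_comm {v : ℝ × ℝ → ℝ} (h : ContDiff ℝ (⊤ : ℕ∞) v) : px (py v) = py (px v) := by
  have hd : Differentiable ℝ (fderiv ℝ v) :=
    (h.fderiv_right (m := (⊤ : ℕ∞)) (by norm_cast)).differentiable (by simp)
  funext z
  have hs : IsSymmSndFDerivAt ℝ v z :=
    (h.contDiffAt).isSymmSndFDerivAt (by
      simp only [minSmoothness_of_isRCLikeNormedField]; norm_cast)
  have key : ∀ c d : ℝ × ℝ, fderiv ℝ (fun w => fderiv ℝ v w c) z d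
      = fderiv ℝ (fderiv ℝ v) z d c := by
    intro c d
    have := ((hd z).hasFDerivAt.clm_apply (hasFDerivAt_const c z)).fderiv
    rw [this]; simp
  show fderiv ℝ (fun w => fderiv ℝ v w (0, 1)) z (1, 0)
    = fderiv ℝ (fun w => fderiv ℝ v w (1, 0)) z (0, 1)
  rw [key, key]
  exact hs _ _

/-- Differentiating a linear identity valid on an open set. -/
lemma fderiv_lin {U : Set (ℝ × ℝ)} (hU : IsOpen U) {A B C F : ℝ × ℝ → ℝ} (c d e : ℝ)
    (hA : ContDiff ℝ (⊤ : ℕ∞) A) (hB : ContDiff ℝ (⊤ : ℕ∞) B) (hC : ContDiff ℝ (⊤ : ℕ∞) C)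
    (h : ∀ z ∈ U, c * A z + d * B z + e * C z = F z) (w : ℝ × ℝ) :
    ∀ z ∈ U, c * fderiv ℝ A z w + d * fderiv ℝ B z w + e * fderiv ℝ C z w
      = fderiv ℝ F z w := by
  intro z hz
  have he : (fun z => c * A z + d * B z + e * C z) =ᶠ[nhds z] F :=
    Filter.eventuallyEq_of_mem (hU.mem_nhds hz) h
  rw [← he.fderiv_eq]
  have := ((((smooth_diff hA z).hasFDerivAt.const_mul c).add
    ((smooth_diff hB z).hasFDerivAt.const_mul d)).add
    ((smooth_diff hC z).hasFDerivAt.const_mul e)).fderiv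
  have h2 := congrArg (fun L => L w) this
  simp only [ContinuousLinearMap.add_apply, ContinuousLinearMap.smul_apply, smul_eq_mul] at h2
  exact h2.symm

/-- Tangential differentiation along the horizontal segment. -/
lemma px_seg {β a b : ℝ} {v w : ℝ × ℝ → ℝ} (hv : ContDiff ℝ (⊤ : ℕ∞) v)
    (hw : ContDiff ℝ (⊤ : ℕ∞) w) (h : ∀ x ∈ Set.Ioo a b, v (x, β) = w (x, β)) :
    ∀ x ∈ Set.Ioo a b, px v (x, β) = px w (x, β) := by
  intro x hx
  have key : ∀ {g : ℝ × ℝ → ℝ}, ContDiff ℝ (⊤ : ℕ∞) g →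
      deriv (fun t : ℝ => g (t, β)) x = px g (x, β) := by
    intro g hg
    have h1 : HasDerivAt (fun t : ℝ => (t, β)) ((1 : ℝ), (0 : ℝ)) x :=
      (hasDerivAt_id x).prodMk (hasDerivAt_const x β)
    exact ((smooth_diff hg (x, β)).hasFDerivAt.comp_hasDerivAt x h1).deriv
  rw [← key hv, ← key hw]
  exact Filter.EventuallyEq.deriv_eq
    (Filter.eventuallyEq_of_mem (isOpen_Ioo.mem_nhds hx) h)

theorem horizontal_boundary_condition_u1
    (ν : ℝ) (hν : 0 < ν) (β a b : ℝ) (U : Set (ℝ × ℝ)) (hU : IsOpen U)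
    (hseg : ∀ x ∈ Set.Ioo a b, (x, β) ∈ U)
    (u₁ u₂ f₁ f₂ p φ g₂ : ℝ × ℝ → ℝ)
    (hu₁ : ContDiff ℝ (⊤ : ℕ∞) u₁) (hu₂ : ContDiff ℝ (⊤ : ℕ∞) u₂)
    (hf₁ : ContDiff ℝ (⊤ : ℕ∞) f₁) (hf₂ : ContDiff ℝ (⊤ : ℕ∞) f₂)
    (hp : ContDiff ℝ (⊤ : ℕ∞) p) (hφ : ContDiff ℝ (⊤ : ℕ∞) φ)
    (hg₂ : ContDiff ℝ (⊤ : ℕ∞) g₂)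
    (hm1 : ∀ z ∈ U, -ν * lap u₁ z + px p z = f₁ z)
    (hm2 : ∀ z ∈ U, -ν * lap u₂ z + py p z = f₂ z)
    (hdiv : ∀ z ∈ U, -(px u₁ z) - py u₂ z = φ z)
    (hbc : ∀ x ∈ Set.Ioo a b, u₂ (x, β) = g₂ (x, β)) :
    ∀ x ∈ Set.Ioo a b,
      py (py (py u₁)) (x, β) + 2 * px (px (py u₁)) (x, β)
        = -ν⁻¹ * (py f₁ (x, β) - px f₂ (x, β)) - px (py φ) (x, β)
          + px (px (px g₂)) (x, β) := by
  intro x hx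
  have hz := hseg x hx
  have e1 := fderiv_lin hU (F := f₁) (-ν) (-ν) 1 (smooth_px (smooth_px hu₁))
    (smooth_py (smooth_py hu₁)) (smooth_px hp)
    (fun z hz => by rw [← hm1 z hz]; simp only [lap]; ring) (0, 1) (x, β) hz
  have e2 := fderiv_lin hU (F := f₂) (-ν) (-ν) 1 (smooth_px (smooth_px hu₂))
    (smooth_py (smooth_py hu₂)) (smooth_py hp)
    (fun z hz => by rw [← hm2 z hz]; simp only [lap]; ring) (1, 0) (x, β) hz
  have e3 := fderiv_lin hU (F := py φ) (-1) (-1) 0 (smooth_py (smooth_px hu₁))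
    (smooth_py (smooth_py hu₂)) hp
    (fun z hz => by
      have := fderiv_lin hU (F := φ) (-1) (-1) 0 (smooth_px hu₁) (smooth_py hu₂) hp
        (fun z hz => by rw [← hdiv z hz]; ring) (0, 1) z hz
      simp only [py] at this ⊢
      linarith) (1, 0) (x, β) hz
  have e4 := px_seg (smooth_px (smooth_px hu₂)) (smooth_px (smooth_px hg₂))
    (px_seg (smooth_px hu₂) (smooth_px hg₂) (px_seg hu₂ hg₂ hbc)) x hx
  change -ν * py (px (px u₁)) (x, β) + -ν * py (py (py u₁)) (x, β) + 1 * py (px p) (x, β)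
    = py f₁ (x, β) at e1
  change -ν * px (px (px u₂)) (x, β) + -ν * px (py (py u₂)) (x, β) + 1 * px (py p) (x, β)
    = px f₂ (x, β) at e2
  change -1 * px (py (px u₁)) (x, β) + -1 * px (py (py u₂)) (x, β) + 0 * px p (x, β)
    = px (py φ) (x, β) at e3
  rw [← px_py_comm (smooth_px hu₁), ← px_py_comm hu₁] at e1
  rw [← px_py_comm hu₁] at e3
  rw [px_py_comm hp] at e2
  rw [← e1, ← e2, ← e3, ← e4]
  field_simp
  ring
end
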